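/- arXiv:2510.17103 — 3 statements merged into one kernel-verified Lean document; each statement's English description precedes it below -/
import Mathlib

section
/- Fix a layered episodic MDP with transition function P and a policy π, generate a random trajectory under π, and let c be a real random variable on the same probability space whose conditional expectation given the trajectory equals Σ_{k=0}^{L−1} ℓ(s_k, a_k) for a loss function ℓ : S × A → ℝ. Fix s ∈ S ∖ {s_L} and a ∈ A with π(a|s) > 0, let u_s > 0 be a real number, and set u(s,a) = u_s·π(a|s). Then the estimator ℓ^u(s,a) = (c·𝕀(s,a) + (1 − π(a|s) − c)·𝕀(s)·π(a|s)) / u(s,a) − (1 − π(a|s)) satisfies E[ ℓ^u(s,a) ] = (q(s)/u_s)·( Q^{P,π}(s,a; ℓ) − V^{P,π}(s; ℓ) + 1 − π(a|s) ) − (1 − π(a|s)). -/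
open MeasureTheory Finset

/-- A layered episodic MDP: finite state set `S` partitioned into layers `0, …, L` by `layer`,
with unique initial state `s0` (layer `0`), unique terminal state `sL` (layer `L`),
nonempty layers, and a transition function `P` supported on consecutive layers with rows
summing to `1` on non-terminal layers. -/
structure LayeredMDP (S A : Type) [Fintype S] [Fintype A] where
  L : ℕ
  layer : S → ℕ
  s0 : S
  sL : S
  P : S → A → S → ℝ
  layer_le : ∀ s, layer s ≤ L
  layer_s0 : layer s0 = 0
  layer_sL : layer sL = L
  s0_unique : ∀ s, layer s = 0 → s = s0
  sL_unique : ∀ s, layer s = L → s = sL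
  layer_nonempty : ∀ k, k ≤ L → ∃ s, layer s = k
  P_nonneg : ∀ s a s', 0 ≤ P s a s'
  P_layer : ∀ s a s', P s a s' ≠ 0 → layer s' = layer s + 1
  P_sum : ∀ s a, layer s < L → ∑ s', P s a s' = 1

variable {S A : Type} [Fintype S] [Fintype A] [DecidableEq S] [DecidableEq A]

/-- `pol` is a policy: nonnegative, and rows sum to `1` at every non-terminal state. -/
def IsPolicy (M : LayeredMDP S A) (pol : S → A → ℝ) : Prop :=
  (∀ s a, 0 ≤ pol s a) ∧ ∀ s, s ≠ M.sL → ∑ a, pol s a = 1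

/-- State-action value function computed with `n` remaining layers of fuel. -/
noncomputable def Qfuel (M : LayeredMDP S A) (pol l : S → A → ℝ) :
    ℕ → S → A → ℝ
  | 0, _, _ => 0
  | n + 1, s, a => l s a + ∑ s', M.P s a s' * ∑ a', pol s' a' * Qfuel M pol l n s' a'

/-- The state-action value function `Q^{P,π}(s,a; ℓ)`. -/
noncomputable def Qval (M : LayeredMDP S A) (pol l : S → A → ℝ) (s : S) (a : A) : ℝ :=
  if M.layer s = M.L then 0 else Qfuel M pol l (M.L - M.layer s) s a

/-- The state value function `V^{P,π}(s; ℓ) = ∑_a π(a|s) Q^{P,π}(s,a; ℓ)`. -/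
noncomputable def Vval (M : LayeredMDP S A) (pol l : S → A → ℝ) (s : S) : ℝ :=
  ∑ a, pol s a * Qval M pol l s a

/-- A trajectory `(s_0, a_0, …, s_{L-1}, a_{L-1}, s_L)`. -/
abbrev Traj (M : LayeredMDP S A) : Type := (Fin (M.L + 1) → S) × (Fin M.L → A)

/-- Probability of a given trajectory under policy `pol`. -/
noncomputable def trajProb (M : LayeredMDP S A) (pol : S → A → ℝ) (τ : Traj M) : ℝ :=
  (if τ.1 0 = M.s0 then (1 : ℝ) else 0) *
    ∏ k : Fin M.L, pol (τ.1 k.castSucc) (τ.2 k) * M.P (τ.1 k.castSucc) (τ.2 k) (τ.1 k.succ)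

/-- Indicator `𝕀(s)` that the trajectory visits state `s` at its layer. -/
noncomputable def stInd (M : LayeredMDP S A) (τ : Traj M) (s : S) : ℝ :=
  if τ.1 ⟨M.layer s, Nat.lt_succ_of_le (M.layer_le s)⟩ = s then 1 else 0

/-- Indicator `𝕀(s,a)` that the trajectory visits `(s,a)` at the layer of `s`. -/
noncomputable def saInd (M : LayeredMDP S A) (τ : Traj M) (s : S) (a : A) : ℝ :=
  if h : M.layer s < M.L then
    if τ.1 ⟨M.layer s, Nat.lt_succ_of_le (M.layer_le s)⟩ = s ∧ τ.2 ⟨M.layer s, h⟩ = a then 1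
    else 0
  else 0

/-- Occupancy measure `q^{P,π}(s,a) = Pr[(s_k, a_k) = (s,a)]`. -/
noncomputable def occSA (M : LayeredMDP S A) (pol : S → A → ℝ) (s : S) (a : A) : ℝ :=
  ∑ τ : Traj M, trajProb M pol τ * saInd M τ s a

/-- Occupancy measure `q^{P,π}(s) = Pr[s_k = s]`. -/
noncomputable def occS (M : LayeredMDP S A) (pol : S → A → ℝ) (s : S) : ℝ :=
  ∑ τ : Traj M, trajProb M pol τ * stInd M τ s

/-- Aggregate loss `∑_{k=0}^{L-1} ℓ(s_k, a_k)` of a trajectory. -/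
noncomputable def aggLoss (M : LayeredMDP S A) (l : S → A → ℝ) (τ : Traj M) : ℝ :=
  ∑ k : Fin M.L, l (τ.1 k.castSucc) (τ.2 k)

section Rollout

set_option linter.unusedSectionVars false

/-- Expectation of `F` over the `n`-step trajectories started at `x`. -/
noncomputable def rollout (P : S → A → S → ℝ) (pol : S → A → ℝ) :
    (n : ℕ) → S → ((Fin (n + 1) → S) → (Fin n → A) → ℝ) → ℝ
  | 0, x, F => F (fun _ => x) Fin.elim0
  | n + 1, x, F => ∑ a, pol x a * ∑ x', P x a x' *
      rollout P pol n x' fun σ α => F (Fin.cons x σ) (Fin.cons a α)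

theorem sum_fin_cons {X : Type} [Fintype X] (n : ℕ) (f : (Fin (n + 1) → X) → ℝ) :
    ∑ σ, f σ = ∑ x, ∑ σ : Fin n → X, f (Fin.cons x σ) := by
  rw [← (Fin.consEquiv (fun _ : Fin (n + 1) => X)).sum_comp, Fintype.sum_prod_type]
  rfl

theorem sum_prod_eq_rollout (P : S → A → S → ℝ) (pol : S → A → ℝ) (n : ℕ) (x : S)
    (F : (Fin (n + 1) → S) → (Fin n → A) → ℝ) :
    ∑ σ : Fin (n + 1) → S, ∑ α : Fin n → A,
      (if σ 0 = x then (1 : ℝ) else 0) *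
        (∏ k : Fin n, pol (σ k.castSucc) (α k) * P (σ k.castSucc) (α k) (σ k.succ)) * F σ α
      = rollout P pol n x F := by
  induction n generalizing x with
  | zero =>
    rw [sum_fin_cons, Finset.sum_eq_single x]
    · simp only [Fin.cons_zero, Finset.univ_unique, Finset.sum_singleton, rollout,
        Finset.univ_eq_empty, Finset.prod_empty, if_true, one_mul]
      congr 1
      funext i
      rw [Fin.fin_one_eq_zero i, Fin.cons_zero]
    · intro y _ hy
      simp [hy]
    · simp
  | succ n ih =>
    rw [sum_fin_cons, Finset.sum_eq_single x]
    · simp only [rollout, ← ih, sum_fin_cons n (X := A)]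
      rw [Finset.sum_comm]
      refine Finset.sum_congr rfl fun a _ => ?_
      simp only [Finset.mul_sum]
      symm
      rw [Finset.sum_comm]
      refine Finset.sum_congr rfl fun σ _ => ?_
      rw [Finset.sum_comm]
      refine Finset.sum_congr rfl fun α _ => ?_
      rw [Finset.sum_eq_single (σ 0)]
      · simp only [Fin.prod_univ_succ, Fin.cons_zero, Fin.cons_succ, Fin.castSucc_zero,
          Fin.castSucc_succ, if_true]
        ring
      · intro y _ hy
        simp [hy.symm]
      · simp
    · intro y _ hy
      simp [hy]
    · simp

theorem rollout_add (P : S → A → S → ℝ) (pol : S → A → ℝ) (n : ℕ) (x : S)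
    (F G : (Fin (n + 1) → S) → (Fin n → A) → ℝ) :
    rollout P pol n x (fun σ α => F σ α + G σ α) = rollout P pol n x F + rollout P pol n x G := by
  induction n generalizing x with
  | zero => rfl
  | succ n ih => simp only [rollout, ih, mul_add, Finset.sum_add_distrib]

theorem rollout_const_mul (P : S → A → S → ℝ) (pol : S → A → ℝ) (n : ℕ) (x : S) (r : ℝ)
    (F : (Fin (n + 1) → S) → (Fin n → A) → ℝ) :
    rollout P pol n x (fun σ α => r * F σ α) = r * rollout P pol n x F := by
  induction n generalizing x with
  | zero => rfl
  | succ n ih => simp only [rollout, ih, Finset.mul_sum, mul_left_comm]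

theorem IsPolicy.sum_eq_one {M : LayeredMDP S A} {pol : S → A → ℝ} (hpol : IsPolicy M pol)
    {x : S} (hx : M.layer x < M.L) : ∑ a, pol x a = 1 :=
  hpol.2 x fun h => (h ▸ hx).ne M.layer_sL

/-- The value of a one-step average only depends on values at the next layer. -/
theorem LayeredMDP.sum_P_mul_congr (M : LayeredMDP S A) {x : S} {a : A} {f g : S → ℝ}
    (h : ∀ x', M.layer x' = M.layer x + 1 → f x' = g x') :
    ∑ x', M.P x a x' * f x' = ∑ x', M.P x a x' * g x' := by
  refine Finset.sum_congr rfl fun x' _ => ?_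
  by_cases hP : M.P x a x' = 0
  · simp [hP]
  · rw [h x' (M.P_layer _ _ _ hP)]

theorem rollout_const {M : LayeredMDP S A} {pol : S → A → ℝ} (hpol : IsPolicy M pol) (r : ℝ)
    (n : ℕ) (x : S) (hx : M.layer x + n = M.L) :
    rollout M.P pol n x (fun _ _ => r) = r := by
  induction n generalizing x with
  | zero => rfl
  | succ n ih =>
    have hlt : M.layer x < M.L := by omega
    simp only [rollout]
    have : ∀ a, ∑ x', M.P x a x' * rollout M.P pol n x' (fun _ _ => r) = r := fun a => by
      rw [M.sum_P_mul_congr (g := fun _ => r) fun x' hx' => ih x' (by omega), ← Finset.sum_mul,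
        M.P_sum x a hlt, one_mul]
    simp only [this, ← Finset.sum_mul, hpol.sum_eq_one hlt, one_mul]

theorem rollout_sum_loss {M : LayeredMDP S A} {pol : S → A → ℝ} (hpol : IsPolicy M pol)
    (l : S → A → ℝ) (n : ℕ) (x : S) (hx : M.layer x + n = M.L) :
    rollout M.P pol n x (fun σ α => ∑ k, l (σ k.castSucc) (α k))
      = ∑ a, pol x a * Qfuel M pol l n x a := by
  induction n generalizing x with
  | zero => simp [rollout, Qfuel]
  | succ n ih =>
    have hlt : M.layer x < M.L := by omega
    simp only [rollout, Qfuel, Fin.sum_univ_succ, Fin.cons_zero, Fin.cons_succ, Fin.castSucc_zero,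
      Fin.castSucc_succ, rollout_add]
    refine Finset.sum_congr rfl fun a _ => ?_
    rw [M.sum_P_mul_congr (g := fun x' => l x a + ∑ a', pol x' a' * Qfuel M pol l n x' a')
      fun x' hx' => by rw [rollout_const hpol _ n x' (by omega), ih x' (by omega)]]
    simp only [mul_add, Finset.sum_add_distrib, ← Finset.sum_mul, M.P_sum x a hlt, one_mul]

/-- Conditioning on visiting `s` at step `h`, correlating the total loss with the centred indicator
of taking `a` yields the advantage of `a`; losses before step `h` enter only through the
constant `r`. -/
theorem rollout_advantage {M : LayeredMDP S A} {pol : S → A → ℝ} (hpol : IsPolicy M pol)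
    (l : S → A → ℝ) (s : S) (a : A) (n : ℕ) (h : Fin n) (r : ℝ) (x : S)
    (hx : M.layer x + n = M.L) :
    rollout M.P pol n x (fun σ α => (r + ∑ k, l (σ k.castSucc) (α k)) *
        ((Pi.single s 1 : S → ℝ) (σ h.castSucc) * ((Pi.single a 1 : A → ℝ) (α h) - pol s a)))
      = pol s a * (Qfuel M pol l (n - h) s a - ∑ b, pol s b * Qfuel M pol l (n - h) s b) *
        rollout M.P pol n x (fun σ _ => (Pi.single s 1 : S → ℝ) (σ h.castSucc)) := by
  induction n generalizing r x with
  | zero => exact h.elim0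
  | succ n ih =>
    have hlt : M.layer x < M.L := by omega
    refine Fin.cases ?_ (fun h => ?_) h
    · simp only [rollout, Fin.sum_univ_succ, Fin.cons_zero, Fin.cons_succ, Fin.castSucc_zero,
        Fin.castSucc_succ, Fin.val_zero, Nat.sub_zero]
      by_cases hxs : x = s
      · subst hxs
        have hQ : ∀ b, ∑ x', M.P x b x' * rollout M.P pol n x' (fun σ α =>
            (r + (l x b + ∑ k, l (σ k.castSucc) (α k))) *
              (1 * ((Pi.single a 1 : A → ℝ) b - pol x a)))
            = (r + Qfuel M pol l (n + 1) x b) * ((Pi.single a 1 : A → ℝ) b - pol x a) := by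
          intro b
          rw [M.sum_P_mul_congr (g := fun x' => (r + l x b) *
              ((Pi.single a 1 : A → ℝ) b - pol x a) + (∑ a', pol x' a' * Qfuel M pol l n x' a') *
              ((Pi.single a 1 : A → ℝ) b - pol x a))]
          · simp only [mul_add, Finset.sum_add_distrib, ← Finset.sum_mul, ← mul_assoc,
              M.P_sum x b hlt, one_mul, Qfuel]
            ring
          · intro x' hx'
            rw [← rollout_sum_loss hpol l n x' (by omega), mul_comm (rollout _ _ _ _ _),
              ← rollout_const_mul, ← rollout_const hpol ((r + l x b) * _) n x' (by omega),
              ← rollout_add]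
            congr 1
            funext σ α
            ring
        have h1 : ∀ b, ∑ x', M.P x b x' * rollout M.P pol n x'
            (fun _ _ => (1 : ℝ)) = 1 := by
          intro b
          rw [M.sum_P_mul_congr (g := fun _ => 1) fun x' hx' => by
            rw [rollout_const hpol _ n x' (by omega)]]
          simp [M.P_sum x b hlt]
        simp only [Pi.single_eq_same, hQ, h1, mul_one, hpol.sum_eq_one hlt]
        have hexp : ∀ b, pol x b * ((r + Qfuel M pol l (n + 1) x b) *
            ((Pi.single a 1 : A → ℝ) b - pol x a))
            = (if b = a then pol x b * (r + Qfuel M pol l (n + 1) x b) else 0)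
              - (pol x b * (pol x a * r) + pol x a * (pol x b * Qfuel M pol l (n + 1) x b)) := by
          intro b
          rw [Pi.single_apply]
          split_ifs <;> ring
        simp only [hexp, Finset.sum_sub_distrib, Finset.sum_add_distrib, Finset.sum_ite_eq',
          Finset.mem_univ, if_true, ← Finset.sum_mul, ← Finset.mul_sum, hpol.sum_eq_one hlt]
        ring
      · have h0 : ∀ x', rollout M.P pol n x' (fun _ _ => (0 : ℝ)) = 0 := fun x' => by
          simpa using rollout_const_mul M.P pol n x' 0 (fun _ _ => 0)
        simp [hxs, h0]
    · simp only [rollout, Fin.sum_univ_succ, Fin.cons_zero, Fin.cons_succ, Fin.castSucc_zero,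
        Fin.castSucc_succ, Fin.val_succ, Nat.add_sub_add_right, ← add_assoc]
      have hpull : ∀ (C : ℝ) (b : A) (f : S → ℝ),
          pol x b * ∑ x', M.P x b x' * (C * f x') = C * (pol x b * ∑ x', M.P x b x' * f x') := by
        intro C b f
        simp only [mul_left_comm _ C, ← Finset.mul_sum]
      rw [Finset.mul_sum]
      refine Finset.sum_congr rfl fun b _ => ?_
      rw [M.sum_P_mul_congr fun x' hx' => ih h (r + l x b) x' (by omega)]
      exact hpull _ _ _

theorem sum_trajProb_mul (M : LayeredMDP S A) (pol : S → A → ℝ) (F : Traj M → ℝ) :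
    ∑ τ, trajProb M pol τ * F τ = rollout M.P pol M.L M.s0 (fun σ α => F (σ, α)) := by
  rw [← sum_prod_eq_rollout, Fintype.sum_prod_type]
  rfl

theorem sum_trajProb_advantage {M : LayeredMDP S A} {pol : S → A → ℝ} (hpol : IsPolicy M pol)
    (l : S → A → ℝ) {s : S} (a : A) (hs : s ≠ M.sL) :
    ∑ τ, trajProb M pol τ * (aggLoss M l τ * (saInd M τ s a - stInd M τ s * pol s a))
      = pol s a * (Qval M pol l s a - Vval M pol l s) * occS M pol s := by
  have hlt : M.layer s < M.L := lt_of_le_of_ne (M.layer_le s) fun h => hs (M.sL_unique s h)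
  have key := rollout_advantage hpol l s a M.L ⟨M.layer s, hlt⟩ 0 M.s0 (by simp [M.layer_s0])
  rw [occS, sum_trajProb_mul, sum_trajProb_mul]
  simp only [Vval, Qval, if_neg hlt.ne]
  simp only [Pi.single_apply, zero_add, Fin.castSucc_mk] at key
  simp only [aggLoss, saInd, stInd, dif_pos hlt]
  rw [← key]
  congr 1
  funext σ α
  congr 1
  by_cases h1 : σ ⟨M.layer s, Nat.lt_succ_of_le (M.layer_le s)⟩ = s <;> simp [h1]

end Rollout

/-- Integrating against a function of a finitely valued map with measurable fibres. -/
theorem integrable_and_integral_mul_comp {Ω T : Type} [Fintype T] [MeasurableSpace Ω] {μ : Measure Ω}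
    {X : Ω → T} (hX : ∀ t, MeasurableSet {ω | X ω = t}) {f : Ω → ℝ} (hf : Integrable f μ)
    (g : T → ℝ) :
    Integrable (fun ω => f ω * g (X ω)) μ ∧
      ∫ ω, f ω * g (X ω) ∂μ = ∑ t, g t * ∫ ω in {ω | X ω = t}, f ω ∂μ := by
  classical
  have heq : (fun ω => f ω * g (X ω))
      = fun ω => ∑ t, g t * Set.indicator {ω | X ω = t} f ω := by
    funext ω
    simp [Set.indicator_apply, mul_comm]
  have hi : ∀ t ∈ (Finset.univ : Finset T),
      Integrable (fun ω => g t * Set.indicator {ω | X ω = t} f ω) μ :=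
    fun t _ => (hf.indicator (hX t)).const_mul _
  rw [heq]
  refine ⟨integrable_finsetSum _ hi, ?_⟩
  rw [integral_finsetSum _ hi]
  refine Finset.sum_congr rfl fun t _ => ?_
  rw [integral_const_mul, integral_indicator (hX t)]

/-- expectation of the optimistic loss estimator `ℓ^u`.
With `u(s,a) = u_s·π(a|s)`, the estimator
`ℓ^u(s,a) = (c·𝕀(s,a) + (1 − π(a|s) − c)·𝕀(s)·π(a|s))/u(s,a) − (1 − π(a|s))` satisfies
`E[ℓ^u(s,a)] = (q(s)/u_s)·(Q^{P,π}(s,a;ℓ) − V^{P,π}(s;ℓ) + 1 − π(a|s)) − (1 − π(a|s))`. -/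
theorem stmt2 (M : LayeredMDP S A) (pol : S → A → ℝ) (hpol : IsPolicy M pol)
    (l : S → A → ℝ)
    {Ω : Type} [MeasurableSpace Ω] (μ : Measure Ω) [IsProbabilityMeasure μ]
    (traj : Ω → Traj M) (c : Ω → ℝ)
    (hmeas : ∀ τ : Traj M, MeasurableSet {ω | traj ω = τ})
    (hdist : ∀ τ : Traj M, (μ {ω | traj ω = τ}).toReal = trajProb M pol τ)
    (hint : Integrable c μ)
    (hcond : ∀ τ : Traj M,
      ∫ ω in {ω | traj ω = τ}, c ω ∂μ = aggLoss M l τ * (μ {ω | traj ω = τ}).toReal)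
    (s : S) (a : A) (hs : s ≠ M.sL) (hpa : 0 < pol s a)
    (us : ℝ) (hus : 0 < us) :
    ∫ ω, ((c ω * saInd M (traj ω) s a
          + (1 - pol s a - c ω) * stInd M (traj ω) s * pol s a) / (us * pol s a)
        - (1 - pol s a)) ∂μ
      = (occS M pol s / us) * (Qval M pol l s a - Vval M pol l s + 1 - pol s a)
        - (1 - pol s a) := by
  obtain ⟨hi1, he1⟩ := integrable_and_integral_mul_comp hmeas hint
    (fun τ => saInd M τ s a - stInd M τ s * pol s a)
  obtain ⟨hi2, he2⟩ := integrable_and_integral_mul_comp hmeas (integrable_const (μ := μ) (1 : ℝ))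
    (fun τ => stInd M τ s)
  have h1 : ∫ ω, c ω * (saInd M (traj ω) s a - stInd M (traj ω) s * pol s a) ∂μ
      = pol s a * (Qval M pol l s a - Vval M pol l s) * occS M pol s := by
    rw [he1, ← sum_trajProb_advantage hpol l a hs]
    refine Finset.sum_congr rfl fun τ _ => ?_
    rw [hcond, hdist]
    ring
  have h2 : ∫ ω, 1 * stInd M (traj ω) s ∂μ = occS M pol s := by
    rw [he2, occS]
    refine Finset.sum_congr rfl fun τ _ => ?_
    rw [setIntegral_const, Measure.real, hdist, smul_eq_mul, mul_one, mul_comm]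
  have heq : (fun ω => (c ω * saInd M (traj ω) s a
          + (1 - pol s a - c ω) * stInd M (traj ω) s * pol s a) / (us * pol s a)
        - (1 - pol s a))
      = fun ω => ((us * pol s a)⁻¹ * (c ω * (saInd M (traj ω) s a - stInd M (traj ω) s * pol s a))
        + (1 - pol s a) / us * (1 * stInd M (traj ω) s)) - (1 - pol s a) := by
    funext ω
    field_simp
    ring
  have hi : Integrable (fun ω =>
      (us * pol s a)⁻¹ * (c ω * (saInd M (traj ω) s a - stInd M (traj ω) s * pol s a))
        + (1 - pol s a) / us * (1 * stInd M (traj ω) s)) μ :=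
    (hi1.const_mul (us * pol s a)⁻¹).add (hi2.const_mul ((1 - pol s a) / us))
  rw [heq, integral_sub hi (integrable_const _),
    integral_add (hi1.const_mul _) (hi2.const_mul _), integral_const_mul, integral_const_mul,
    h1, h2, integral_const, probReal_univ, one_smul]
  field_simp
  ring
end

section
/- Fix a layered episodic MDP with transition function P and a policy π, generate a random trajectory under π, and let c be a real random variable on the same probability space whose conditional expectation given the trajectory equals Σ_{k=0}^{L−1} ℓ(s_k, a_k), where ℓ : S × A → [0, ∞) is a nonnegative loss function. Fix s ∈ S ∖ {s_L} and a ∈ A with π(a|s) > 0, and assume 0 ≤ Q^{P,π}(s, a'; ℓ) ≤ 1 for every a' ∈ A. Let u_s be a real number with u_s ≥ q(s) and u_s > 0, and set u(s,a) = u_s·π(a|s). Then the estimator ℓ^u(s,a) = (c·𝕀(s,a) + (1 − π(a|s) − c)·𝕀(s)·π(a|s)) / u(s,a) − (1 − π(a|s)) is optimistic in expectation: E[ ℓ^u(s,a) ] ≤ Q^{P,π}(s,a; ℓ) − V^{P,π}(s; ℓ). -/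
open MeasureTheory Finset

variable {S A : Type} [Fintype S] [Fintype A] [DecidableEq S] [DecidableEq A]

set_option linter.unusedSectionVars false

/-- Weighted sum of `F` over all length-`n` trajectories starting at `x`. -/
noncomputable def pathSum (M : LayeredMDP S A) (pol : S → A → ℝ) (n : ℕ) (x : S)
    (F : (Fin (n + 1) → S) × (Fin n → A) → ℝ) : ℝ :=
  ∑ τ : (Fin (n + 1) → S) × (Fin n → A), (if τ.1 0 = x then (1 : ℝ) else 0) *
    (∏ k : Fin n, pol (τ.1 k.castSucc) (τ.2 k) * M.P (τ.1 k.castSucc) (τ.2 k) (τ.1 k.succ)) * F τ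

theorem pathSum_zero (M : LayeredMDP S A) (pol : S → A → ℝ) (x : S)
    (F : (Fin 1 → S) × (Fin 0 → A) → ℝ) :
    pathSum M pol 0 x F = F (fun _ => x, Fin.elim0) := by
  unfold pathSum
  rw [Fintype.sum_eq_single ((fun _ => x, Fin.elim0) : (Fin 1 → S) × (Fin 0 → A))]
  · simp
  · rintro ⟨f, g⟩ hne
    have : f 0 ≠ x := by
      rintro h
      apply hne
      ext i
      · rw [Subsingleton.elim i 0]
        exact h
      · exact i.elim0
    simp [this]

/-- First-step decomposition of a sum over trajectories. -/
theorem pathSum_succ (M : LayeredMDP S A) (pol : S → A → ℝ) (n : ℕ) (x : S)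
    (F : (Fin (n + 2) → S) × (Fin (n + 1) → A) → ℝ) :
    pathSum M pol (n + 1) x F = ∑ a, pol x a * ∑ x', M.P x a x' *
      pathSum M pol n x' (fun τ => F (Fin.cons x τ.1, Fin.cons a τ.2)) := by
  have key : ∀ G : (Fin (n + 2) → S) × (Fin (n + 1) → A) → ℝ,
      ∑ τ, G τ = ∑ x, ∑ a, ∑ τ : (Fin (n + 1) → S) × (Fin n → A),
        G (Fin.cons x τ.1, Fin.cons a τ.2) := by
    intro G
    rw [Fintype.sum_prod_type, ← (Fin.consEquiv (fun _ => S)).sum_comp, Fintype.sum_prod_type]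
    refine Finset.sum_congr rfl fun x _ => ?_
    have : ∀ f : Fin (n + 1) → S,
        ∑ y, G (Fin.consEquiv (fun _ => S) (x, f), y)
          = ∑ a, ∑ g : Fin n → A, G (Fin.cons x f, Fin.cons a g) := by
      intro f
      rw [← (Fin.consEquiv (fun _ => A)).sum_comp, Fintype.sum_prod_type]
      rfl
    simp_rw [this]
    rw [Finset.sum_comm]
    refine Finset.sum_congr rfl fun a _ => ?_
    rw [Fintype.sum_prod_type]
  unfold pathSum
  rw [key, Fintype.sum_eq_single x]
  · refine Finset.sum_congr rfl fun a _ => ?_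
    simp_rw [Finset.mul_sum]
    rw [Finset.sum_comm]
    refine Finset.sum_congr rfl fun τ _ => ?_
    rw [Fintype.sum_eq_single (τ.1 0)]
    · rw [Fin.prod_univ_succ]
      simp [Fin.castSucc_succ]
      ring
    · intro x' hx'
      simp [hx'.symm]
  · intro y hy
    simp [hy]

section Layered

variable (M : LayeredMDP S A) {pol : S → A → ℝ} (l : S → A → ℝ)

/-- Averaging over successors only sees states of the next layer. -/
theorem LayeredMDP.sum_P_congr (x : S) (a : A) (f g : S → ℝ)
    (h : ∀ x', M.layer x' = M.layer x + 1 → f x' = g x') :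
    ∑ x', M.P x a x' * f x' = ∑ x', M.P x a x' * g x' := by
  refine Finset.sum_congr rfl fun x' _ => ?_
  by_cases h0 : M.P x a x' = 0
  · simp [h0]
  · rw [h x' (M.P_layer _ _ _ h0)]

/-- Expectation of an affine function of the aggregate loss. -/
theorem pathSum_affine (hpol : IsPolicy M pol) (n : ℕ) (x : S) (hx : M.layer x + n = M.L)
    (b t : ℝ) :
    pathSum M pol n x (fun τ => b + t * ∑ k : Fin n, l (τ.1 k.castSucc) (τ.2 k))
      = b + t * ∑ a, pol x a * Qfuel M pol l n x a := by
  induction n generalizing x b with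
  | zero => simp [pathSum_zero, Qfuel]
  | succ n ih =>
    have hlt : M.layer x < M.L := by omega
    have hne : x ≠ M.sL := by
      rintro rfl
      exact hlt.ne M.layer_sL
    rw [pathSum_succ]
    have step : ∀ a, ∑ x', M.P x a x' * pathSum M pol n x' (fun τ => b + t *
          ∑ k : Fin (n + 1), l ((Fin.cons x τ.1 : Fin (n + 2) → S) k.castSucc)
            ((Fin.cons a τ.2 : Fin (n + 1) → A) k)) = b + t * Qfuel M pol l (n + 1) x a := by
      intro a
      simp_rw [Fin.sum_univ_succ, Fin.castSucc_succ, Fin.castSucc_zero, Fin.cons_zero,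
        Fin.cons_succ, mul_add, ← add_assoc]
      rw [M.sum_P_congr x a _ _ (fun x' hx' => ih x' (by omega) _)]
      simp_rw [mul_add, Finset.sum_add_distrib, ← Finset.sum_mul, M.P_sum x a hlt, Qfuel,
        mul_left_comm _ t, ← Finset.mul_sum]
      ring
    simp_rw [step, mul_add, Finset.sum_add_distrib, ← Finset.sum_mul, hpol.2 x hne,
      mul_left_comm _ t, ← Finset.mul_sum]
    ring

theorem pathSum_const (hpol : IsPolicy M pol) (n : ℕ) (x : S) (hx : M.layer x + n = M.L)
    (b : ℝ) : pathSum M pol n x (fun _ => b) = b := by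
  simpa using pathSum_affine M 0 hpol n x hx b 0

/-- Correlation of the aggregate loss with the centred indicator of an action at step `j`. -/
theorem pathSum_advantage (hpol : IsPolicy M pol) (s : S) (a : A) (n : ℕ) (j : Fin n) (x : S)
    (hx : M.layer x + n = M.L) (b : ℝ) :
    pathSum M pol n x (fun τ => (b + ∑ k : Fin n, l (τ.1 k.castSucc) (τ.2 k)) *
        ((if τ.1 j.castSucc = s ∧ τ.2 j = a then 1 else 0)
          - pol s a * if τ.1 j.castSucc = s then 1 else 0))
      = pathSum M pol n x (fun τ => if τ.1 j.castSucc = s then 1 else 0) * (pol s a *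
        (Qfuel M pol l (n - j) s a - ∑ a', pol s a' * Qfuel M pol l (n - j) s a')) := by
  induction n generalizing x b with
  | zero => exact j.elim0
  | succ n ih =>
    have hlt : M.layer x < M.L := by omega
    have hne : x ≠ M.sL := by
      rintro rfl
      exact hlt.ne M.layer_sL
    rw [pathSum_succ, pathSum_succ]
    simp_rw [Fin.sum_univ_succ, Fin.castSucc_succ, Fin.castSucc_zero, Fin.cons_zero,
      Fin.cons_succ, ← add_assoc]
    refine Fin.cases ?_ (fun j => ?_) j
    · simp only [Fin.castSucc_zero, Fin.cons_zero, Fin.val_zero, Nat.sub_zero]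
      by_cases hxs : x = s
      · subst hxs
        have h1 : ∀ a', ∑ x', M.P x a' x' * pathSum M pol n x' (fun _ => 1) = 1 := by
          intro a'
          rw [M.sum_P_congr x a' _ _ (fun x' hx' => pathSum_const M hpol n x' (by omega) _)]
          simp [M.P_sum x a' hlt]
        have h2 : ∀ a', ∑ x', M.P x a' x' * pathSum M pol n x' (fun τ =>
              (b + l x a' + ∑ k : Fin n, l (τ.1 k.castSucc) (τ.2 k)) *
                ((if a' = a then 1 else 0) - pol x a))
            = ((if a' = a then 1 else 0) - pol x a) * (b + Qfuel M pol l (n + 1) x a') := by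
          intro a'
          set d : ℝ := (if a' = a then 1 else 0) - pol x a
          have h3 : ∀ x', M.layer x' = M.layer x + 1 → pathSum M pol n x' (fun τ =>
              (b + l x a' + ∑ k : Fin n, l (τ.1 k.castSucc) (τ.2 k)) * d)
              = (b + l x a') * d + d * ∑ a, pol x' a * Qfuel M pol l n x' a := by
            intro x' hx'
            rw [← pathSum_affine M l hpol n x' (by omega)]
            congr 1
            ext τ
            ring
          rw [M.sum_P_congr x a' _ _ h3]
          simp_rw [mul_add, Finset.sum_add_distrib, ← Finset.sum_mul, M.P_sum x a' hlt, Qfuel,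
            mul_left_comm _ d, ← Finset.mul_sum]
          ring
        simp only [true_and, if_true, mul_one, h1, h2, hpol.2 x hne, one_mul]
        have h4 : ∀ a', pol x a' * (((if a' = a then 1 else 0) - pol x a) *
            (b + Qfuel M pol l (n + 1) x a'))
            = (if a' = a then pol x a' * (b + Qfuel M pol l (n + 1) x a') else 0)
              - pol x a * b * pol x a' - pol x a * (pol x a' * Qfuel M pol l (n + 1) x a') := by
          intro a'
          split_ifs <;> ring
        simp_rw [h4, Finset.sum_sub_distrib, ← Finset.mul_sum, hpol.2 x hne]
        simp
        ring
      · simp [hxs, pathSum]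
    · simp only [Fin.castSucc_succ, Fin.cons_succ, Fin.val_succ, Nat.add_sub_add_right]
      rw [Finset.sum_mul]
      refine Finset.sum_congr rfl fun a' _ => ?_
      rw [mul_assoc, Finset.sum_mul,
        M.sum_P_congr x a' _ _ (fun x' hx' => ih j x' (by omega) _)]
      simp_rw [mul_assoc]

end Layered

/-- Expectation of `c · f(traj) + g(traj)` for `c` with conditional mean `m` given a
finitely-valued `traj`. -/
theorem integral_mul_comp_add_comp {Ω T : Type*} [Fintype T] [MeasurableSpace Ω] (μ : Measure Ω)
    [IsFiniteMeasure μ] (traj : Ω → T) (c : Ω → ℝ)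
    (hmeas : ∀ τ, MeasurableSet {ω | traj ω = τ}) (hint : Integrable c μ) (m : T → ℝ)
    (hcond : ∀ τ, ∫ ω in {ω | traj ω = τ}, c ω ∂μ = m τ * (μ {ω | traj ω = τ}).toReal)
    (f g : T → ℝ) :
    ∫ ω, (c ω * f (traj ω) + g (traj ω)) ∂μ
      = ∑ τ, (μ {ω | traj ω = τ}).toReal * (m τ * f τ + g τ) := by
  have hc : ∀ τ, Set.EqOn (fun ω => c ω * f (traj ω) + g (traj ω))
      (fun ω => c ω * f τ + g τ) {ω | traj ω = τ} := by
    rintro τ ω rfl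
    rfl
  have hi : ∀ τ, Integrable (fun ω => c ω * f τ + g τ) μ := fun τ =>
    (hint.mul_const _).add (integrable_const _)
  have hU : (⋃ τ, {ω | traj ω = τ}) = Set.univ := by
    ext ω
    simp
  rw [← setIntegral_univ, ← hU, integral_iUnion_fintype hmeas]
  · refine Finset.sum_congr rfl fun τ _ => ?_
    rw [setIntegral_congr_fun (hmeas τ) (hc τ),
      integral_add (hint.mul_const _).integrableOn (integrable_const _),
      integral_mul_const, hcond]
    simp [Measure.real]
    ring
  · intro τ τ' h
    rw [Function.onFun, Set.disjoint_left]
    rintro ω rfl h'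
    exact h h'
  · exact fun τ => (hi τ).integrableOn.congr_fun (hc τ).symm (hmeas τ)

/-- the estimator `ℓ^u` is optimistic in expectation.
If `ℓ ≥ 0`, the `Q`-values at `s` lie in `[0,1]`, and `u_s ≥ q(s)`, `u_s > 0`, then with
`u(s,a) = u_s·π(a|s)` the estimator `ℓ^u(s,a)` satisfies
`E[ℓ^u(s,a)] ≤ Q^{P,π}(s,a;ℓ) − V^{P,π}(s;ℓ)`. -/
theorem stmt3 (M : LayeredMDP S A) (pol : S → A → ℝ) (hpol : IsPolicy M pol)
    (l : S → A → ℝ) (hl : ∀ s a, 0 ≤ l s a)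
    {Ω : Type} [MeasurableSpace Ω] (μ : Measure Ω) [IsProbabilityMeasure μ]
    (traj : Ω → Traj M) (c : Ω → ℝ)
    (hmeas : ∀ τ : Traj M, MeasurableSet {ω | traj ω = τ})
    (hdist : ∀ τ : Traj M, (μ {ω | traj ω = τ}).toReal = trajProb M pol τ)
    (hint : Integrable c μ)
    (hcond : ∀ τ : Traj M,
      ∫ ω in {ω | traj ω = τ}, c ω ∂μ = aggLoss M l τ * (μ {ω | traj ω = τ}).toReal)
    (s : S) (a : A) (hs : s ≠ M.sL) (hpa : 0 < pol s a)
    (hQ : ∀ a' : A, Qval M pol l s a' ∈ Set.Icc (0 : ℝ) 1)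
    (us : ℝ) (hus0 : 0 < us) (hus : occS M pol s ≤ us) :
    ∫ ω, ((c ω * saInd M (traj ω) s a
          + (1 - pol s a - c ω) * stInd M (traj ω) s * pol s a) / (us * pol s a)
        - (1 - pol s a)) ∂μ
      ≤ Qval M pol l s a - Vval M pol l s := by
  have hlt : M.layer s < M.L := lt_of_le_of_ne (M.layer_le s) fun h => hs (M.sL_unique s h)
  have hQv : ∀ a', Qval M pol l s a' = Qfuel M pol l (M.L - M.layer s) s a' := fun a' =>
    if_neg hlt.ne
  have hL : M.layer M.s0 + M.L = M.L := by rw [M.layer_s0, zero_add]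
  have hmass : ∑ τ : Traj M, trajProb M pol τ = 1 := by
    simpa [pathSum, trajProb] using pathSum_const M hpol M.L M.s0 hL 1
  have hadv : ∑ τ : Traj M, trajProb M pol τ *
      (aggLoss M l τ * (saInd M τ s a - pol s a * stInd M τ s))
      = occS M pol s * (pol s a * (Qval M pol l s a - Vval M pol l s)) := by
    simpa [pathSum, trajProb, aggLoss, saInd, stInd, occS, hlt, Vval, hQv] using
      pathSum_advantage M l hpol s a M.L ⟨M.layer s, hlt⟩ M.s0 hL 0
  have hE := integral_mul_comp_add_comp μ traj c hmeas hint (aggLoss M l) hcond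
    (fun τ => (saInd M τ s a - pol s a * stInd M τ s) / (us * pol s a))
    (fun τ => (1 - pol s a) / us * stInd M τ s - (1 - pol s a))
  have hval : ∑ τ : Traj M, (μ {ω | traj ω = τ}).toReal *
      (aggLoss M l τ * ((saInd M τ s a - pol s a * stInd M τ s) / (us * pol s a))
        + ((1 - pol s a) / us * stInd M τ s - (1 - pol s a)))
      = occS M pol s * (pol s a * (Qval M pol l s a - Vval M pol l s)) / (us * pol s a)
        + (1 - pol s a) / us * occS M pol s - (1 - pol s a) := by
    have h1 : (1 - pol s a) = (1 - pol s a) * ∑ τ : Traj M, trajProb M pol τ := by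
      rw [hmass, mul_one]
    rw [← hadv, occS]
    nth_rewrite 4 [h1]
    simp_rw [hdist, Finset.sum_div, Finset.mul_sum, ← Finset.sum_add_distrib,
      ← Finset.sum_sub_distrib]
    refine Finset.sum_congr rfl fun τ _ => ?_
    ring
  have hcongr : ∀ ω, (c ω * saInd M (traj ω) s a
      + (1 - pol s a - c ω) * stInd M (traj ω) s * pol s a) / (us * pol s a) - (1 - pol s a)
      = c ω * ((saInd M (traj ω) s a - pol s a * stInd M (traj ω) s) / (us * pol s a))
        + ((1 - pol s a) / us * stInd M (traj ω) s - (1 - pol s a)) := by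
    intro ω
    field_simp
    ring
  simp_rw [hcongr]
  rw [hE, hval]
  have hV : Vval M pol l s ≤ pol s a * Qval M pol l s a + (1 - pol s a) := by
    rw [Vval, ← hpol.2 s hs, ← Finset.add_sum_erase _ _ (Finset.mem_univ a),
      ← Finset.add_sum_erase _ (fun a' => pol s a') (Finset.mem_univ a), add_sub_cancel_left]
    gcongr with a' _
    exact mul_le_of_le_one_right (hpol.1 s a') (hQ a').2
  have hp1 : pol s a ≤ 1 := by
    rw [← hpol.2 s hs]
    exact Finset.single_le_sum (fun a' _ => hpol.1 s a') (Finset.mem_univ a)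
  have hgap : 0 ≤ Qval M pol l s a - Vval M pol l s + (1 - pol s a) := by
    nlinarith [mul_nonneg (sub_nonneg.2 hp1) (hQ a).1]
  have hfrac : occS M pol s / us ≤ 1 := (div_le_one hus0).2 hus
  have hrw : occS M pol s * (pol s a * (Qval M pol l s a - Vval M pol l s)) / (us * pol s a)
        + (1 - pol s a) / us * occS M pol s - (1 - pol s a)
      = occS M pol s / us * (Qval M pol l s a - Vval M pol l s + (1 - pol s a))
        - (1 - pol s a) := by
    field_simp
  rw [hrw]
  nlinarith [mul_nonneg (sub_nonneg.2 hfrac) hgap]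
end

section
/- Let G = (V ∪ {s, g}, E) be a finite directed acyclic graph with source s and sink g, let q ∈ 𝒬 be a unit s–g flow with q(e) > 0 for every e ∈ E, and let p be a random s–g path drawn by the Markovian path sampler associated with q. Let ℓ : E → ℝ, and let c be a real random variable on the same probability space whose conditional expectation given p equals Σ_{e : p(e)=1} ℓ(e). Define the loss estimator ℓ̂(e) = c·( p(e)/q(e) − p(e_-)/q(e_-) ) for each e ∈ E, where p(v) and q(v) are the vertex marginals (with p(s) = q(s) = 1). Then for any two flows q', q'' ∈ 𝒬: E[ ⟨ℓ̂, q' − q''⟩ ] = ⟨ℓ, q' − q''⟩, where ⟨f, r⟩ = Σ_{e ∈ E} f(e)·r(e). -/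
open MeasureTheory Finset

variable {V E : Type}

/-- `IsTrail src tgt u v l`: the list of edges `l` forms a directed walk from `u` to `v`. -/
def IsTrail (src tgt : E → V) : V → V → List E → Prop
  | u, v, [] => u = v
  | u, v, e :: rest => src e = u ∧ IsTrail src tgt (tgt e) v rest

/-- `p : E → Bool` is the indicator vector of an `s`–`g` path. -/
def IsPathVec (src tgt : E → V) (s g : V) (p : E → Bool) : Prop :=
  ∃ l : List E, IsTrail src tgt s g l ∧ ∀ e, p e = true ↔ e ∈ l

/-- The real indicator vector of a Boolean edge set. -/
noncomputable def pathVec (p : E → Bool) : E → ℝ := fun e => if p e then 1 else 0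

/-- `𝒫`: the set of indicator vectors of `s`–`g` paths, as vectors in `ℝ^E`. -/
def pathSet (src tgt : E → V) (s g : V) : Set (E → ℝ) :=
  {x | ∃ p : E → Bool, IsPathVec src tgt s g p ∧ x = pathVec p}

/-- `𝒬 = conv(𝒫)`: the set of unit `s`–`g` flows. -/
noncomputable def flowSet (src tgt : E → V) (s g : V) : Set (E → ℝ) :=
  convexHull ℝ (pathSet src tgt s g)

variable [Fintype V] [Fintype E] [DecidableEq V] [DecidableEq E]

/-- `q(v) = ∑_{e ∈ ∂₊v} q(e)`: total flow on the edges leaving `v`. -/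
noncomputable def outSum (src : E → V) (q : E → ℝ) (v : V) : ℝ :=
  ∑ e ∈ Finset.univ.filter (fun e => src e = v), q e

/-- The weight `w(p) = ∏_{e : p(e)=1} q(e)/q(e_-)` of a path under the Markovian sampler
associated with `q` (with the Lean convention `r/0 = 0`, so in particular `0/0 = 0`). -/
noncomputable def pathWeight (src : E → V) (q : E → ℝ) (p : E → Bool) : ℝ :=
  ∏ e ∈ Finset.univ.filter (fun e => p e = true), q e / outSum src q (src e)

open Classical in
/-- The (finite) set of indicator vectors of `s`–`g` paths. -/
noncomputable def pathFinset (src tgt : E → V) (s g : V) : Finset (E → Bool) :=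
  Finset.univ.filter (IsPathVec src tgt s g)

/-- Vertex marginal of an edge vector, with the convention that the marginal at the
source `s` equals `1`. -/
noncomputable def vertMarg (src : E → V) (s : V) (x : E → ℝ) (v : V) : ℝ :=
  if v = s then 1 else ∑ e ∈ Finset.univ.filter (fun e => src e = v), x e

section Trails

variable {src tgt : E → V} {rk : V → ℕ}

omit [Fintype V] [Fintype E] [DecidableEq V] [DecidableEq E] in
lemma IsTrail.rk_le (hrk : ∀ e, rk (src e) < rk (tgt e)) {u v : V} {t : List E}
    (h : IsTrail src tgt u v t) : rk u ≤ rk v := by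
  induction t generalizing u with
  | nil => exact (congrArg rk h).le
  | cons e t ih =>
    obtain ⟨rfl, h⟩ := h
    exact (hrk e).le.trans (ih h)

omit [Fintype V] [Fintype E] [DecidableEq V] [DecidableEq E] in
lemma IsTrail.rk_le_src (hrk : ∀ e, rk (src e) < rk (tgt e)) {u v : V} {t : List E}
    (h : IsTrail src tgt u v t) {e : E} (he : e ∈ t) : rk u ≤ rk (src e) := by
  induction t generalizing u with
  | nil => simp at he
  | cons f t ih =>
    obtain ⟨rfl, h⟩ := h
    rcases List.mem_cons.1 he with rfl | he
    · exact le_rfl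
    · exact (hrk f).le.trans (ih h he)

omit [Fintype V] [Fintype E] [DecidableEq V] [DecidableEq E] in
lemma IsTrail.rk_tgt_le (hrk : ∀ e, rk (src e) < rk (tgt e)) {u v : V} {t : List E}
    (h : IsTrail src tgt u v t) {e : E} (he : e ∈ t) : rk (tgt e) ≤ rk v := by
  induction t generalizing u with
  | nil => simp at he
  | cons f t ih =>
    obtain ⟨rfl, h⟩ := h
    rcases List.mem_cons.1 he with rfl | he
    · exact h.rk_le hrk
    · exact ih h he

omit [Fintype V] [Fintype E] [DecidableEq V] [DecidableEq E] in
lemma IsTrail.notMem_of_rk_le (hrk : ∀ e, rk (src e) < rk (tgt e)) {e f : E} {v : V}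
    {t : List E} (h : IsTrail src tgt (tgt e) v t) (hf : rk (src f) ≤ rk (src e)) : f ∉ t :=
  fun hm => absurd (h.rk_le_src hrk hm) (not_le.2 (hf.trans_lt (hrk e)))

omit [Fintype V] [Fintype E] [DecidableEq V] [DecidableEq E] in
lemma IsTrail.eq_of_src_eq (hrk : ∀ e, rk (src e) < rk (tgt e)) {u v : V} {t : List E}
    (h : IsTrail src tgt u v t) {e f : E} (he : e ∈ t) (hf : f ∈ t) (hef : src e = src f) :
    e = f := by
  induction t generalizing u with
  | nil => simp at he
  | cons d t ih =>
    obtain ⟨rfl, h⟩ := h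
    rcases List.mem_cons.1 he with rfl | he' <;> rcases List.mem_cons.1 hf with rfl | hf'
    · rfl
    · exact absurd hf' (h.notMem_of_rk_le hrk (by rw [hef]))
    · exact absurd he' (h.notMem_of_rk_le hrk (by rw [hef]))
    · exact ih h he' hf'

omit [Fintype V] [Fintype E] [DecidableEq V] [DecidableEq E] in
lemma IsTrail.nodup (hrk : ∀ e, rk (src e) < rk (tgt e)) {u v : V} {t : List E}
    (h : IsTrail src tgt u v t) : t.Nodup := by
  induction t generalizing u with
  | nil => simp
  | cons d t ih =>
    obtain ⟨rfl, h⟩ := h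
    exact List.nodup_cons.2 ⟨h.notMem_of_rk_le hrk le_rfl, ih h⟩

omit [Fintype V] [Fintype E] [DecidableEq V] [DecidableEq E] in
lemma IsTrail.eq_nil (hrk : ∀ e, rk (src e) < rk (tgt e)) {u : V} {t : List E}
    (h : IsTrail src tgt u u t) : t = [] := by
  cases t with
  | nil => rfl
  | cons e t =>
    obtain ⟨rfl, h⟩ := h
    exact absurd (h.rk_le hrk) (not_le.2 (hrk e))

omit [Fintype V] [Fintype E] [DecidableEq V] [DecidableEq E] in
lemma IsTrail.src_ne (hrk : ∀ e, rk (src e) < rk (tgt e)) {u v : V} {t : List E}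
    (h : IsTrail src tgt u v t) {e : E} (he : e ∈ t) : src e ≠ v := fun h' =>
  absurd (h.rk_tgt_le hrk he) (not_le.2 (h' ▸ hrk e))

omit [Fintype V] [Fintype E] [DecidableEq V] [DecidableEq E] in
lemma IsTrail.tgt_ne (hrk : ∀ e, rk (src e) < rk (tgt e)) {u v : V} {t : List E}
    (h : IsTrail src tgt u v t) {e : E} (he : e ∈ t) : tgt e ≠ u := fun h' =>
  absurd (h.rk_le_src hrk he) (not_le.2 (h' ▸ hrk e))

omit [Fintype V] [Fintype E] [DecidableEq V] [DecidableEq E] in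
lemma IsTrail.tgt_eq_or_exists {u v : V} {t : List E}
    (h : IsTrail src tgt u v t) {e : E} (he : e ∈ t) : tgt e = v ∨ ∃ f, src f = tgt e := by
  induction t generalizing u with
  | nil => simp at he
  | cons d t ih =>
    obtain ⟨rfl, h⟩ := h
    rcases List.mem_cons.1 he with rfl | he
    · cases t with
      | nil => exact Or.inl h
      | cons f t => exact Or.inr ⟨f, h.1⟩
    · exact ih h he

omit [Fintype V] [Fintype E] [DecidableEq V] [DecidableEq E] in
lemma IsTrail.eq_of_mem_iff (hrk : ∀ e, rk (src e) < rk (tgt e)) {u v : V} {t t' : List E}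
    (h : IsTrail src tgt u v t) (h' : IsTrail src tgt u v t') (hm : ∀ e, e ∈ t ↔ e ∈ t') :
    t = t' := by
  induction t generalizing u t' with
  | nil =>
    cases t' with
    | nil => rfl
    | cons f t' => simpa using hm f
  | cons e t ih =>
    cases t' with
    | nil => simpa using hm e
    | cons f t' =>
      obtain rfl : e = f :=
        h'.eq_of_src_eq hrk ((hm e).1 (by simp)) (by simp) (h.1.trans h'.1.symm)
      obtain ⟨rfl, h⟩ := h
      obtain ⟨-, h'⟩ := h'
      rw [ih h h' fun d => ?_]
      have := hm d
      by_cases hd : d = e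
      · subst hd
        exact iff_of_false (h.notMem_of_rk_le hrk le_rfl) (h'.notMem_of_rk_le hrk le_rfl)
      · simpa [hd] using this

omit [Fintype E] [DecidableEq V] [DecidableEq E] in
/-- Induction along the edges of a finite acyclic graph, from the sinks upwards. -/
lemma acyclic_induction (hrk : ∀ e, rk (src e) < rk (tgt e)) {P : V → Prop}
    (step : ∀ u, (∀ e, src e = u → P (tgt e)) → P u) (u : V) : P u := by
  obtain ⟨N, hN⟩ : ∃ N, ∀ v, rk v ≤ N :=
    ⟨Finset.univ.sup rk, fun v => Finset.le_sup (Finset.mem_univ v)⟩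
  induction hn : N - rk u using Nat.strong_induction_on generalizing u with
  | _ n ih =>
    refine step u fun e he => ih _ ?_ (tgt e) rfl
    have := hrk e
    have := hN (tgt e)
    rw [he] at *
    omega

omit [DecidableEq V] [DecidableEq E] in
lemma finite_trails (hrk : ∀ e, rk (src e) < rk (tgt e)) (u v : V) :
    {t | IsTrail src tgt u v t}.Finite := by
  refine acyclic_induction hrk (P := fun u => {t | IsTrail src tgt u v t}.Finite) ?_ u
  intro u ih
  have hfin : ({[]} ∪ ⋃ e ∈ {e | src e = u}, List.cons e ''
      {t | IsTrail src tgt (tgt e) v t}).Finite :=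
    (Set.finite_singleton _).union
      ((Set.toFinite _).biUnion fun e he => (ih e he).image _)
  refine hfin.subset fun t ht => ?_
  cases t with
  | nil => simp
  | cons e t =>
    refine Or.inr (Set.mem_biUnion (x := e) ht.1 ⟨t, ht.2, rfl⟩)

/-- The real-valued indicator of an edge lying on a list of edges. -/
noncomputable def edgeInd (e : E) (t : List E) : ℝ := if e ∈ t then 1 else 0

/-- The Boolean indicator vector of a list of edges. -/
def listVec (t : List E) : E → Bool := fun e => decide (e ∈ t)

omit [Fintype E] in
lemma pathVec_listVec (t : List E) (e : E) : pathVec (listVec t) e = edgeInd e t := by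
  simp [pathVec, listVec, edgeInd]

omit [Fintype V] [DecidableEq V] in
lemma IsTrail.sum_mul_edgeInd (hrk : ∀ e, rk (src e) < rk (tgt e)) {u v : V} {t : List E}
    (h : IsTrail src tgt u v t) (a : E → ℝ) : ∑ e, a e * edgeInd e t = (t.map a).sum := by
  rw [← List.sum_toFinset a (h.nodup hrk)]
  simp [edgeInd, ← List.mem_toFinset]

omit [Fintype V] [Fintype E] [DecidableEq V] [DecidableEq E] in
lemma IsTrail.sum_potential {u v : V} {t : List E} (h : IsTrail src tgt u v t) (D : V → ℝ) :
    (t.map fun e => D (tgt e) - D (src e)).sum = D v - D u := by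
  induction t generalizing u with
  | nil => simp [show u = v from h]
  | cons e t ih =>
    obtain ⟨rfl, h⟩ := h
    simp [ih h]

omit [Fintype V] [Fintype E] [DecidableEq V] in
lemma isPathVec_iff {s g : V} {p : E → Bool} :
    IsPathVec src tgt s g p ↔ ∃ t, IsTrail src tgt s g t ∧ p = listVec t := by
  refine exists_congr fun t => and_congr_right fun _ => ⟨fun h => ?_, ?_⟩
  · funext e
    rw [Bool.eq_iff_iff, h e, listVec, decide_eq_true_iff]
  · rintro rfl e
    simp [listVec]

omit [Fintype V] [DecidableEq V] [DecidableEq E] in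
lemma sum_mul_eq_of_mem_flowSet {s g : V} {a : E → ℝ} {b : ℝ}
    (hab : ∀ t, IsTrail src tgt s g t → ∀ p : E → Bool, (∀ e, p e = true ↔ e ∈ t) →
      ∑ e, a e * pathVec p e = b)
    {x : E → ℝ} (hx : x ∈ flowSet src tgt s g) : ∑ e, a e * x e = b := by
  have hconv : Convex ℝ {x : E → ℝ | ∑ e, a e * x e = b} := by
    intro x hx y hy α β _ _ hαβ
    simp only [Set.mem_ofPred_eq] at hx hy ⊢
    calc ∑ e, a e * (α • x + β • y) e
        = α * ∑ e, a e * x e + β * ∑ e, a e * y e := by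
          rw [Finset.mul_sum, Finset.mul_sum, ← Finset.sum_add_distrib]
          exact Finset.sum_congr rfl fun e _ => by simp; ring
      _ = b := by rw [hx, hy, ← add_mul, hαβ, one_mul]
  refine convexHull_min ?_ hconv hx
  rintro _ ⟨p, ⟨t, ht, hp⟩, rfl⟩
  exact hab t ht p hp

omit [Fintype V] [DecidableEq V] in
lemma sum_potential_of_mem_flowSet (hrk : ∀ e, rk (src e) < rk (tgt e)) {s g : V} {x : E → ℝ}
    (hx : x ∈ flowSet src tgt s g) (D : V → ℝ) :
    ∑ e, (D (tgt e) - D (src e)) * x e = D g - D s := by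
  refine sum_mul_eq_of_mem_flowSet (fun t ht p hp => ?_) hx
  obtain rfl : p = listVec t := funext fun e => by
    rw [Bool.eq_iff_iff, hp e, listVec, decide_eq_true_iff]
  simp_rw [pathVec_listVec]
  rw [ht.sum_mul_edgeInd hrk, ht.sum_potential]

omit [Fintype V] [DecidableEq V] in
/-- An edge carrying flow lies on some path. -/
lemma exists_trail_of_pos {s g : V} {x : E → ℝ} (hx : x ∈ flowSet src tgt s g) {e : E}
    (he : 0 < x e) : ∃ t, IsTrail src tgt s g t ∧ e ∈ t := by
  by_contra! hno
  have := sum_mul_eq_of_mem_flowSet (a := fun f => if f = e then 1 else 0) (b := 0)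
    (fun t ht p hp => ?_) hx
  · simp at this
    exact he.ne' this
  · have : p e = false := by
      rw [← Bool.not_eq_true, hp e]
      exact hno t ht
    refine Finset.sum_eq_zero fun f _ => ?_
    by_cases hf : f = e
    · simp [pathVec, hf, this]
    · simp [hf]

omit [Fintype V] in
lemma outSum_eq_inSum (hrk : ∀ e, rk (src e) < rk (tgt e)) {s g : V} {x : E → ℝ}
    (hx : x ∈ flowSet src tgt s g) {v : V} (hv : v ≠ g) :
    outSum src x v = (∑ e ∈ Finset.univ.filter (fun e => tgt e = v), x e)
      + if v = s then 1 else 0 := by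
  have := sum_potential_of_mem_flowSet hrk hx fun w => if w = v then 1 else 0
  simp only [sub_mul, Finset.sum_sub_distrib, ite_mul, one_mul, zero_mul, hv.symm, if_false,
    zero_sub, ← Finset.sum_filter] at this
  rw [outSum]
  simp only [eq_comm (a := v)]
  linarith

omit [Fintype V] in
lemma vertMarg_eq_outSum (hrk : ∀ e, rk (src e) < rk (tgt e)) {s g : V} {x : E → ℝ}
    (hx : x ∈ flowSet src tgt s g) {v : V} (hv : v ≠ g) :
    vertMarg src s x v = outSum src x v := by
  rw [vertMarg]
  split_ifs with h
  · subst h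
    have hin := sum_mul_eq_of_mem_flowSet (src := src) (tgt := tgt) (s := v) (g := g)
      (a := fun e => if tgt e = v then 1 else 0) (b := 0) (fun t ht p hp => ?_) hx
    · rw [outSum_eq_inSum hrk hx hv, Finset.sum_filter]
      simpa using hin
    · refine Finset.sum_eq_zero fun e _ => ?_
      by_cases he : e ∈ t
      · simp [ht.tgt_ne hrk he]
      · simp [pathVec, show p e = false by rw [← Bool.not_eq_true, hp e]; exact he]
  · rfl

/-- The sum of `F` over a finite family of edge lists, weighted by the product of `K`. -/
noncomputable def trailSum (K : E → ℝ) (T : Finset (List E)) (F : List E → ℝ) : ℝ :=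
  ∑ t ∈ T, (t.map K).prod * F t

section trailSum

variable {g : V} {T : V → Finset (List E)} {K : E → ℝ}

omit [Fintype V] [Fintype E] [DecidableEq V] [DecidableEq E] in
lemma trailSum_congr {S : Finset (List E)} {F G : List E → ℝ} (h : ∀ t ∈ S, F t = G t) :
    trailSum K S F = trailSum K S G :=
  Finset.sum_congr rfl fun t ht => by rw [h t ht]

omit [Fintype V] [Fintype E] [DecidableEq V] [DecidableEq E] in
lemma trailSum_const_mul {S : Finset (List E)} (b : ℝ) (F : List E → ℝ) :
    trailSum K S (fun t => b * F t) = b * trailSum K S F := by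
  rw [trailSum, trailSum, Finset.mul_sum]
  exact Finset.sum_congr rfl fun t _ => by ring

omit [Fintype V] [Fintype E] [DecidableEq V] [DecidableEq E] in
lemma trailSum_zero {S : Finset (List E)} : trailSum K S (fun _ => 0) = 0 := by
  simp [trailSum]

omit [Fintype V] [Fintype E] [DecidableEq V] [DecidableEq E] in
lemma trailSum_add {S : Finset (List E)} (F G : List E → ℝ) :
    trailSum K S (fun t => F t + G t) = trailSum K S F + trailSum K S G := by
  simp [trailSum, mul_add, Finset.sum_add_distrib]

omit [Fintype V] [Fintype E] [DecidableEq V] [DecidableEq E] in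
lemma trailSum_sum {ι : Type*} {S : Finset (List E)} (I : Finset ι) (F : ι → List E → ℝ) :
    trailSum K S (fun t => ∑ i ∈ I, F i t) = ∑ i ∈ I, trailSum K S (F i) := by
  simp only [trailSum, Finset.mul_sum]
  exact Finset.sum_comm

omit [Fintype V] [Fintype E] [DecidableEq V] [DecidableEq E] in
lemma trailSum_self (hrk : ∀ e, rk (src e) < rk (tgt e))
    (hT : ∀ u t, t ∈ T u ↔ IsTrail src tgt u g t) (F : List E → ℝ) :
    trailSum K (T g) F = F [] := by
  have : T g = {[]} := by
    ext t
    rw [hT, Finset.mem_singleton]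
    exact ⟨fun h => h.eq_nil hrk, fun h => h ▸ rfl⟩
  simp [trailSum, this]

omit [Fintype V] [DecidableEq E] in
lemma trailSum_step (hT : ∀ u t, t ∈ T u ↔ IsTrail src tgt u g t) {u : V} (hu : u ≠ g)
    (F : List E → ℝ) :
    trailSum K (T u) F = ∑ e ∈ Finset.univ.filter (fun e => src e = u),
      K e * trailSum K (T (tgt e)) (fun t => F (e :: t)) := by
  simp only [trailSum, Finset.mul_sum]
  rw [Finset.sum_sigma']
  symm
  refine Finset.sum_bij (fun x _ => x.1 :: x.2) ?_ ?_ ?_ ?_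
  · rintro ⟨e, t⟩ h
    simp only [Finset.mem_sigma, Finset.mem_filter, Finset.mem_univ, true_and, hT] at h ⊢
    exact h
  · rintro ⟨e, t⟩ _ ⟨e', t'⟩ _ h
    obtain ⟨rfl, rfl⟩ := List.cons.inj h
    rfl
  · intro t ht
    rw [hT] at ht
    cases t with
    | nil => exact absurd ht hu
    | cons e t =>
      obtain ⟨rfl, ht⟩ := ht
      exact ⟨⟨e, t⟩, by simpa [hT] using ht, rfl⟩
  · rintro ⟨e, t⟩ _
    simp [mul_assoc]

omit [DecidableEq E] in
lemma trailSum_one (hrk : ∀ e, rk (src e) < rk (tgt e))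
    (hT : ∀ u t, t ∈ T u ↔ IsTrail src tgt u g t)
    (hK : ∀ e, ∑ f ∈ Finset.univ.filter (fun f => src f = src e), K f = 1)
    (hg : ∀ e, tgt e = g ∨ ∃ f, src f = tgt e) (u : V) (hu : u = g ∨ ∃ f, src f = u) :
    trailSum K (T u) (fun _ => 1) = 1 := by
  revert hu
  refine acyclic_induction hrk
    (P := fun u => (u = g ∨ ∃ f, src f = u) → trailSum K (T u) (fun _ => 1) = 1) ?_ u
  intro u ih hu
  by_cases hug : u = g
  · rw [hug, trailSum_self hrk hT]
  obtain ⟨f, rfl⟩ := hu.resolve_left hug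
  rw [trailSum_step hT hug]
  refine (Finset.sum_congr rfl fun e he => ?_).trans (hK f)
  rw [ih e (by simpa using he) (hg e), mul_one]

lemma trailSum_edgeInd (hrk : ∀ e, rk (src e) < rk (tgt e))
    (hT : ∀ u t, t ∈ T u ↔ IsTrail src tgt u g t)
    (hK : ∀ e, ∑ f ∈ Finset.univ.filter (fun f => src f = src e), K f = 1)
    (hg : ∀ e, tgt e = g ∨ ∃ f, src f = tgt e) {e : E} (he : src e ≠ g) (u : V) :
    trailSum K (T u) (edgeInd e) = K e * trailSum K (T u)
      (fun t => ∑ d ∈ Finset.univ.filter (fun d => src d = src e), edgeInd d t) := by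
  refine acyclic_induction hrk (P := fun u => trailSum K (T u) (edgeInd e) = K e *
    trailSum K (T u) (fun t => ∑ d ∈ Finset.univ.filter (fun d => src d = src e),
      edgeInd d t)) ?_ u
  intro u ih
  by_cases hug : u = g
  · subst hug
    rw [trailSum_self hrk hT, trailSum_self hrk hT]
    simp [edgeInd]
  rw [trailSum_step hT hug, trailSum_step hT hug]
  have hcons : ∀ d d', src d' = src d → ∀ t ∈ T (tgt d'),
      edgeInd d (d' :: t) = if d = d' then 1 else 0 := by
    intro d d' hd t ht
    have : d ∉ t := ((hT _ _).1 ht).notMem_of_rk_le hrk (by rw [hd])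
    simp [edgeInd, this]
  by_cases hue : u = src e
  · subst hue
    have h1 : ∀ d ∈ Finset.univ.filter (fun d => src d = src e),
        K d * trailSum K (T (tgt d)) (fun t => edgeInd e (d :: t)) = if e = d then K d else 0 := by
      intro d hd
      rw [trailSum_congr (hcons e d (by simpa using hd))]
      split_ifs
      · rw [trailSum_one hrk hT hK hg _ (hg d), mul_one]
      · rw [trailSum_zero, mul_zero]
    have h2 : ∀ d ∈ Finset.univ.filter (fun d => src d = src e),
        K d * trailSum K (T (tgt d)) (fun t => ∑ d' ∈ Finset.univ.filter
          (fun d => src d = src e), edgeInd d' (d :: t)) = K d := by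
      intro d hd
      have hd' : src d = src e := by simpa using hd
      rw [trailSum_congr (G := fun _ => 1), trailSum_one hrk hT hK hg _ (hg d), mul_one]
      intro t ht
      rw [Finset.sum_congr rfl fun d' hd'' => hcons d' d
        (by rw [hd']; exact (Finset.mem_filter.1 hd'').2.symm) t ht]
      simp [hd']
    rw [Finset.sum_congr rfl h1, Finset.sum_congr rfl h2, hK e]
    simp
  · rw [Finset.mul_sum]
    refine Finset.sum_congr rfl fun d hd => ?_
    have hd' : src d = u := by simpa using hd
    have hne : ∀ f, src f = src e → ∀ t, edgeInd f (d :: t) = edgeInd f t := by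
      intro f hf t
      have : f ≠ d := by
        rintro rfl
        exact hue (hd'.symm.trans hf)
      simp [edgeInd, this]
    rw [trailSum_congr fun t _ => hne e rfl t, trailSum_congr fun t _ =>
      Finset.sum_congr rfl fun f hf => hne f (Finset.mem_filter.1 hf).2 t]
    have := ih d hd'
    rw [this]
    ring

/-- The Markov property: given the past, the next edge is drawn with the probabilities `K`. -/
lemma trailSum_edgeInd_mul (hrk : ∀ e, rk (src e) < rk (tgt e))
    (hT : ∀ u t, t ∈ T u ↔ IsTrail src tgt u g t)
    (hK : ∀ e, ∑ f ∈ Finset.univ.filter (fun f => src f = src e), K f = 1)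
    (hg : ∀ e, tgt e = g ∨ ∃ f, src f = tgt e) {e f : E} (he : src e ≠ g)
    (hne : src f ≠ src e) (hfe : rk (src f) ≤ rk (src e)) (u : V) :
    trailSum K (T u) (fun t => edgeInd f t * edgeInd e t) = K e * trailSum K (T u)
      (fun t => edgeInd f t *
        ∑ d ∈ Finset.univ.filter (fun d => src d = src e), edgeInd d t) := by
  refine acyclic_induction hrk (P := fun u => trailSum K (T u) (fun t => edgeInd f t *
    edgeInd e t) = K e * trailSum K (T u) (fun t => edgeInd f t *
      ∑ d ∈ Finset.univ.filter (fun d => src d = src e), edgeInd d t)) ?_ u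
  intro u ih
  by_cases hug : u = g
  · subst hug
    rw [trailSum_self hrk hT, trailSum_self hrk hT]
    simp [edgeInd]
  rw [trailSum_step hT hug, trailSum_step hT hug, Finset.mul_sum]
  refine Finset.sum_congr rfl fun d hd => ?_
  have hd' : src d = u := by simpa using hd
  by_cases hue : u = src e
  · have h0 : ∀ t ∈ T (tgt d), edgeInd f (d :: t) = 0 := by
      intro t ht
      have h1 : f ∉ t := ((hT _ _).1 ht).notMem_of_rk_le hrk (by rwa [hd', hue])
      have h2 : f ≠ d := by
        rintro rfl
        exact hne (hd'.trans hue)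
      simp [edgeInd, h1, h2]
    have hz : ∀ F : List E → ℝ,
        trailSum K (T (tgt d)) (fun t => edgeInd f (d :: t) * F t) = 0 := fun F => by
      rw [trailSum_congr (G := fun _ => 0) fun t ht => by simp only [h0 t ht, zero_mul],
        trailSum_zero]
    rw [hz, hz]
    ring
  · have hcons : ∀ d', src d' = src e → ∀ t, edgeInd d' (d :: t) = edgeInd d' t := by
      intro d' hd'' t
      have : d' ≠ d := by
        rintro rfl
        exact hue (hd'.symm.trans hd'')
      simp [edgeInd, this]
    have hsum : ∀ t, ∑ d' ∈ Finset.univ.filter (fun d => src d = src e), edgeInd d' (d :: t) =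
        ∑ d' ∈ Finset.univ.filter (fun d => src d = src e), edgeInd d' t := fun t =>
      Finset.sum_congr rfl fun d' h => hcons d' (Finset.mem_filter.1 h).2 t
    simp only [hcons e rfl, hsum]
    by_cases hfd : f = d
    · have : ∀ t, edgeInd f (d :: t) = 1 := fun t => by simp [edgeInd, hfd]
      simp only [this, one_mul]
      rw [show (fun t => edgeInd e t) = edgeInd e from rfl,
        trailSum_edgeInd hrk hT hK hg he]
      ring
    · have : ∀ t, edgeInd f (d :: t) = edgeInd f t := fun t => by simp [edgeInd, hfd]
      simp only [this]
      rw [ih d hd']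
      ring

end trailSum

section Sampler

variable {s g : V} {T : V → Finset (List E)} {q : E → ℝ}

/-- The transition probabilities `q(e)/q(e_-)` of the Markovian sampler. -/
noncomputable def transProb (src : E → V) (q : E → ℝ) (e : E) : ℝ := q e / outSum src q (src e)

omit [Fintype V] [DecidableEq E] in
lemma outSum_src_pos (hqpos : ∀ e, 0 < q e) (e : E) : 0 < outSum src q (src e) :=
  Finset.sum_pos (fun f _ => hqpos f) ⟨e, by simp⟩

omit [Fintype V] [DecidableEq E] in
lemma sum_transProb (hqpos : ∀ e, 0 < q e) (e : E) :
    ∑ f ∈ Finset.univ.filter (fun f => src f = src e), transProb src q f = 1 := by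
  have : ∀ f ∈ Finset.univ.filter (fun f => src f = src e),
      transProb src q f = q f / outSum src q (src e) := fun f hf => by
    rw [transProb, (Finset.mem_filter.1 hf).2]
  rw [Finset.sum_congr rfl this, ← Finset.sum_div]
  exact div_self (outSum_src_pos hqpos e).ne'

omit [Fintype V] [DecidableEq V] in
lemma src_ne_sink (hrk : ∀ e, rk (src e) < rk (tgt e)) (hq : q ∈ flowSet src tgt s g)
    (hqpos : ∀ e, 0 < q e) (e : E) : src e ≠ g := by
  obtain ⟨t, ht, he⟩ := exists_trail_of_pos hq (hqpos e)
  exact ht.src_ne hrk he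

omit [Fintype V] [DecidableEq V] in
lemma tgt_eq_sink_or (hq : q ∈ flowSet src tgt s g) (hqpos : ∀ e, 0 < q e) (e : E) :
    tgt e = g ∨ ∃ f, src f = tgt e := by
  obtain ⟨t, ht, he⟩ := exists_trail_of_pos hq (hqpos e)
  exact ht.tgt_eq_or_exists he

omit [Fintype V] [Fintype E] [DecidableEq V] [DecidableEq E] in
lemma source_eq_sink_or (hq : q ∈ flowSet src tgt s g) : s = g ∨ ∃ f, src f = s := by
  obtain ⟨_, p, ⟨t, ht, -⟩, -⟩ := convexHull_nonempty_iff.1 ⟨q, hq⟩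
  cases t with
  | nil => exact Or.inl ht
  | cons e t => exact Or.inr ⟨e, ht.1⟩

lemma marginal_mem_flowSet (hrk : ∀ e, rk (src e) < rk (tgt e))
    (hT : ∀ u t, t ∈ T u ↔ IsTrail src tgt u g t)
    (hq : q ∈ flowSet src tgt s g) (hqpos : ∀ e, 0 < q e) :
    (fun e => trailSum (transProb src q) (T s) (edgeInd e)) ∈ flowSet src tgt s g := by
  have hone := trailSum_one hrk hT (sum_transProb (src := src) hqpos) (tgt_eq_sink_or hq hqpos) s
    (source_eq_sink_or hq)
  have : (fun e => trailSum (transProb src q) (T s) (edgeInd e)) =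
      ∑ t ∈ T s, (t.map (transProb src q)).prod • pathVec (listVec t) := by
    funext e
    simp [trailSum, pathVec_listVec]
  rw [this]
  refine (convex_convexHull ℝ _).sum_mem (fun t _ => List.prod_nonneg ?_)
    (by simpa [trailSum] using hone) fun t ht => subset_convexHull ℝ _ ?_
  · simp only [List.mem_map]
    rintro _ ⟨e, -, rfl⟩
    exact (div_pos (hqpos e) (outSum_src_pos hqpos e)).le
  · exact ⟨_, isPathVec_iff.2 ⟨t, (hT _ _).1 ht, rfl⟩, rfl⟩

/-- The edge marginals of the Markovian sampler associated with `q` are `q`. -/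
lemma trailSum_edgeInd_eq (hrk : ∀ e, rk (src e) < rk (tgt e))
    (hT : ∀ u t, t ∈ T u ↔ IsTrail src tgt u g t)
    (hq : q ∈ flowSet src tgt s g) (hqpos : ∀ e, 0 < q e) (e : E) :
    trailSum (transProb src q) (T s) (edgeInd e) = q e := by
  set m : E → ℝ := fun e => trailSum (transProb src q) (T s) (edgeInd e) with hm
  have hmflow : m ∈ flowSet src tgt s g := marginal_mem_flowSet hrk hT hq hqpos
  have hstep : ∀ e, m e = transProb src q e * outSum src m (src e) := fun e => by
    rw [hm, outSum, ← trailSum_sum]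
    exact trailSum_edgeInd hrk hT (sum_transProb hqpos) (tgt_eq_sink_or hq hqpos)
      (src_ne_sink hrk hq hqpos e) s
  have hfinish : ∀ e, outSum src m (src e) = outSum src q (src e) → m e = q e := fun e he => by
    rw [hstep, he, transProb, div_mul_cancel₀ _ (outSum_src_pos hqpos e).ne']
  have hvert : ∀ n v, rk v = n → v ≠ g → outSum src m v = outSum src q v := by
    intro n
    induction n using Nat.strong_induction_on with
    | _ n ih =>
      intro v hv hvg
      rw [outSum_eq_inSum hrk hmflow hvg, outSum_eq_inSum hrk hq hvg]
      congr 1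
      refine Finset.sum_congr rfl fun e he => hfinish e ?_
      refine ih _ ?_ _ rfl (src_ne_sink hrk hq hqpos e)
      rw [← hv, ← (Finset.mem_filter.1 he).2]
      exact hrk e
  exact hfinish e (hvert _ _ rfl (src_ne_sink hrk hq hqpos e))

omit [Fintype V] [Fintype E] [DecidableEq V] in
lemma IsTrail.edgeInd_mul_edgeInd (hrk : ∀ e, rk (src e) < rk (tgt e)) {u v : V} {t : List E}
    (h : IsTrail src tgt u v t) {e f : E} (hef : src f = src e) :
    edgeInd f t * edgeInd e t = if f = e then edgeInd f t else 0 := by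
  split_ifs with hfe
  · subst hfe
    by_cases hf : f ∈ t <;> simp [edgeInd, hf]
  · by_cases hf : f ∈ t
    · have : e ∉ t := fun he => hfe (h.eq_of_src_eq hrk hf he hef)
      simp [edgeInd, this]
    · simp [edgeInd, hf]

/-- The correlation of an edge of the sampled path with the centred edge indicator
`p(e)/q(e) - p(e_-)/q(e_-)`, summed over the edges leaving a vertex against weights `δ` whose
mean under the transition probabilities vanishes at every vertex. -/
lemma sum_centred_correlation (hrk : ∀ e, rk (src e) < rk (tgt e))
    (hT : ∀ u t, t ∈ T u ↔ IsTrail src tgt u g t)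
    (hq : q ∈ flowSet src tgt s g) (hqpos : ∀ e, 0 < q e) {δ : E → ℝ}
    (hδ : ∀ u, ∑ f ∈ Finset.univ.filter (fun f => src f = u), transProb src q f * δ f = 0)
    (e : E) (u : V) :
    ∑ f ∈ Finset.univ.filter (fun f => src f = u), δ f *
      trailSum (transProb src q) (T s) (fun t => edgeInd f t * (edgeInd e t / q e
        - (∑ d ∈ Finset.univ.filter (fun d => src d = src e), edgeInd d t)
          / outSum src q (src e))) = if u = src e then δ e else 0 := by
  set K := transProb src q with hKdef
  set Q := outSum src q (src e) with hQ
  have hQpos : 0 < Q := outSum_src_pos hqpos e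
  have hqe := hqpos e
  have hK := sum_transProb (src := src) hqpos
  have hg := tgt_eq_sink_or hq hqpos
  have hsrc := src_ne_sink hrk hq hqpos
  have hexp : ∀ f, trailSum K (T s) (fun t => edgeInd f t * (edgeInd e t / q e
        - (∑ d ∈ Finset.univ.filter (fun d => src d = src e), edgeInd d t) / Q)) =
      (q e)⁻¹ * trailSum K (T s) (fun t => edgeInd f t * edgeInd e t) + (-Q⁻¹) *
        trailSum K (T s) (fun t => edgeInd f t *
          ∑ d ∈ Finset.univ.filter (fun d => src d = src e), edgeInd d t) := fun f => by
    rw [← trailSum_const_mul, ← trailSum_const_mul, ← trailSum_add]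
    exact trailSum_congr fun t _ => by ring
  simp only [hexp]
  split_ifs with hu
  · subst hu
    have h1 : ∀ f ∈ Finset.univ.filter (fun f => src f = src e), δ f *
        ((q e)⁻¹ * trailSum K (T s) (fun t => edgeInd f t * edgeInd e t) + (-Q⁻¹) *
        trailSum K (T s) (fun t => edgeInd f t *
          ∑ d ∈ Finset.univ.filter (fun d => src d = src e), edgeInd d t)) =
        (if f = e then δ f else 0) - K f * δ f := by
      intro f hf
      have hf' : src f = src e := (Finset.mem_filter.1 hf).2
      have ha : trailSum K (T s) (fun t => edgeInd f t * edgeInd e t) =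
          if f = e then q f else 0 := by
        rw [trailSum_congr fun t ht => ((hT _ _).1 ht).edgeInd_mul_edgeInd hrk hf']
        split_ifs
        · exact trailSum_edgeInd_eq hrk hT hq hqpos f
        · exact trailSum_zero
      have hb : trailSum K (T s) (fun t => edgeInd f t *
          ∑ d ∈ Finset.univ.filter (fun d => src d = src e), edgeInd d t) = q f := by
        rw [← trailSum_edgeInd_eq hrk hT hq hqpos f]
        refine trailSum_congr fun t ht => ?_
        rw [Finset.mul_sum, Finset.sum_congr rfl fun d hd =>
          ((hT _ _).1 ht).edgeInd_mul_edgeInd hrk (hf'.trans (Finset.mem_filter.1 hd).2.symm)]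
        simp [hf']
      rw [ha, hb, hKdef, transProb, hf', ← hQ]
      split_ifs with hfe
      · subst hfe
        field_simp
        ring
      · field_simp
        ring
    rw [Finset.sum_congr rfl h1, Finset.sum_sub_distrib, hδ]
    simp
  · rcases le_or_gt (rk u) (rk (src e)) with hle | hlt
    · refine Finset.sum_eq_zero fun f hf => ?_
      obtain rfl := (Finset.mem_filter.1 hf).2
      rw [trailSum_edgeInd_mul hrk hT hK hg (hsrc e) hu hle, hKdef, transProb, ← hQ]
      field_simp
      ring
    · set W : List E → ℝ := fun t =>
        ∑ d ∈ Finset.univ.filter (fun d => src d = u), edgeInd d t with hW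
      have hpair : ∀ f, src f = u → ∀ d, src d = src e →
          trailSum K (T s) (fun t => edgeInd f t * edgeInd d t) =
            K f * trailSum K (T s) (fun t => edgeInd d t * W t) := by
        rintro f hf d hd
        have := trailSum_edgeInd_mul (e := f) (f := d) hrk hT hK hg (hsrc f)
          (by rw [hf, hd]; exact Ne.symm hu) (by rw [hf, hd]; exact hlt.le) s
        rw [hf] at this
        rw [← this]
        exact trailSum_congr fun t _ => mul_comm _ _
      have h1 : ∀ f ∈ Finset.univ.filter (fun f => src f = u), δ f *
          ((q e)⁻¹ * trailSum K (T s) (fun t => edgeInd f t * edgeInd e t) + (-Q⁻¹) *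
          trailSum K (T s) (fun t => edgeInd f t *
            ∑ d ∈ Finset.univ.filter (fun d => src d = src e), edgeInd d t)) =
          (K f * δ f) * ((q e)⁻¹ * trailSum K (T s) (fun t => edgeInd e t * W t) + (-Q⁻¹) *
            ∑ d ∈ Finset.univ.filter (fun d => src d = src e),
              trailSum K (T s) (fun t => edgeInd d t * W t)) := by
        intro f hf
        have hf' : src f = u := (Finset.mem_filter.1 hf).2
        rw [trailSum_congr fun t _ => Finset.mul_sum _ _ (edgeInd f t), trailSum_sum,
          Finset.sum_congr rfl fun d hd => hpair f hf' d (Finset.mem_filter.1 hd).2,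
          hpair f hf' e rfl, ← Finset.mul_sum]
        ring
      rw [Finset.sum_congr rfl h1, ← Finset.sum_mul, hδ, zero_mul]

/-- The estimator is unbiased up to the potential given by the expected remaining loss. -/
lemma exists_potential_trailSum_estimator (hrk : ∀ e, rk (src e) < rk (tgt e))
    (hT : ∀ u t, t ∈ T u ↔ IsTrail src tgt u g t)
    (hq : q ∈ flowSet src tgt s g) (hqpos : ∀ e, 0 < q e) (a : E → ℝ) :
    ∃ D : V → ℝ, ∀ e, trailSum (transProb src q) (T s) (fun t => (∑ f, a f * edgeInd f t) *
      (edgeInd e t / q e - (∑ d ∈ Finset.univ.filter (fun d => src d = src e), edgeInd d t)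
          / outSum src q (src e))) = a e + (D (tgt e) - D (src e)) := by
  set K := transProb src q with hKdef
  have hK := sum_transProb (src := src) hqpos
  have hg := tgt_eq_sink_or hq hqpos
  have hsrc := src_ne_sink hrk hq hqpos
  set D : V → ℝ := fun u => trailSum K (T u) (fun t => (t.map a).sum) with hD
  set δ : E → ℝ := fun f => a f + (D (tgt f) - D (src f)) with hδdef
  have hDg : D g = 0 := by simp [hD, trailSum_self hrk hT]
  have hDstep : ∀ e, D (src e) = ∑ f ∈ Finset.univ.filter (fun f => src f = src e),
      K f * (a f + D (tgt f)) := fun e => by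
    rw [hD]
    simp only
    rw [trailSum_step hT (hsrc e)]
    refine Finset.sum_congr rfl fun f _ => ?_
    simp only [List.map_cons, List.sum_cons]
    rw [trailSum_add]
    have := trailSum_const_mul (K := K) (S := T (tgt f)) (a f) (fun _ => 1)
    simp only [mul_one] at this
    rw [this, trailSum_one hrk hT hK hg _ (hg f), mul_one]
  have hδ : ∀ u, ∑ f ∈ Finset.univ.filter (fun f => src f = u), K f * δ f = 0 := by
    intro u
    by_cases hu : ∃ e, src e = u
    · obtain ⟨e, rfl⟩ := hu
      have : ∀ f ∈ Finset.univ.filter (fun f => src f = src e),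
          K f * δ f = K f * (a f + D (tgt f)) - K f * D (src e) := fun f hf => by
        rw [hδdef, ← (Finset.mem_filter.1 hf).2]
        ring
      rw [Finset.sum_congr rfl this, Finset.sum_sub_distrib, ← hDstep, ← Finset.sum_mul, hK,
        one_mul, sub_self]
    · refine Finset.sum_eq_zero fun f hf => absurd ⟨f, (Finset.mem_filter.1 hf).2⟩ hu
  refine ⟨D, fun e => ?_⟩
  set X : List E → ℝ := fun t => edgeInd e t / q e
    - (∑ d ∈ Finset.univ.filter (fun d => src d = src e), edgeInd d t)
          / outSum src q (src e) with hX
  have hX0 : trailSum K (T s) X = 0 := by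
    have : trailSum K (T s) X = (q e)⁻¹ * trailSum K (T s) (edgeInd e)
        + (-(outSum src q (src e))⁻¹) * trailSum K (T s) (fun t =>
          ∑ d ∈ Finset.univ.filter (fun d => src d = src e), edgeInd d t) := by
      rw [← trailSum_const_mul, ← trailSum_const_mul, ← trailSum_add]
      exact trailSum_congr fun t _ => by rw [hX]; ring
    rw [this, trailSum_sum, trailSum_edgeInd_eq hrk hT hq hqpos,
      Finset.sum_congr rfl fun d _ => trailSum_edgeInd_eq hrk hT hq hqpos d, ← outSum,
      inv_mul_cancel₀ (hqpos e).ne', neg_mul, inv_mul_cancel₀ (outSum_src_pos hqpos e).ne']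
    ring
  have hloss : ∀ t ∈ T s, (∑ f, a f * edgeInd f t) * X t =
      D s * X t + ∑ f, δ f * (edgeInd f t * X t) := by
    intro t ht
    have ht' := (hT _ _).1 ht
    have hpot := ht'.sum_potential D
    rw [← ht'.sum_mul_edgeInd hrk, hDg] at hpot
    have : ∑ f, δ f * edgeInd f t = ∑ f, a f * edgeInd f t
        + ∑ f, (D (tgt f) - D (src f)) * edgeInd f t := by
      rw [← Finset.sum_add_distrib]
      exact Finset.sum_congr rfl fun f _ => by rw [hδdef]; ring
    simp only [← mul_assoc]
    rw [← Finset.sum_mul, this, hpot]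
    ring
  rw [trailSum_congr hloss, trailSum_add, trailSum_const_mul, hX0, mul_zero, zero_add,
    trailSum_sum]
  simp only [trailSum_const_mul]
  rw [← Finset.sum_fiberwise Finset.univ src]
  simp only [hX]
  rw [Finset.sum_congr rfl fun u _ => sum_centred_correlation hrk hT hq hqpos hδ e u]
  simp [hδdef]

omit [Fintype V] in
lemma pathWeight_listVec (hrk : ∀ e, rk (src e) < rk (tgt e)) {u v : V}
    {t : List E} (h : IsTrail src tgt u v t) :
    pathWeight src q (listVec t) = (t.map (transProb src q)).prod := by
  rw [← List.prod_toFinset _ (h.nodup hrk), pathWeight]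
  refine Finset.prod_congr ?_ fun e _ => rfl
  ext e
  simp [listVec]

omit [Fintype V] in
lemma sum_eq_trailSum (hrk : ∀ e, rk (src e) < rk (tgt e))
    (hT : ∀ u t, t ∈ T u ↔ IsTrail src tgt u g t) {w : (E → Bool) → ℝ}
    (hw₁ : ∀ p, IsPathVec src tgt s g p → w p = pathWeight src q p)
    (hw₂ : ∀ p, ¬ IsPathVec src tgt s g p → w p = 0) (F : (E → Bool) → ℝ) :
    ∑ p, w p * F p = trailSum (transProb src q) (T s) (fun t => F (listVec t)) := by
  symm
  refine Finset.sum_of_injOn listVec ?_ (fun _ _ => Finset.mem_coe.2 (Finset.mem_univ _)) ?_ ?_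
  · intro t ht t' ht' htt
    refine ((hT _ _).1 ht).eq_of_mem_iff hrk ((hT _ _).1 ht') fun e => ?_
    have := congrFun htt e
    simpa [listVec] using this
  · intro p _ hp
    rw [hw₂ p, zero_mul]
    rintro h
    obtain ⟨t, ht, rfl⟩ := isPathVec_iff.1 h
    exact hp ⟨t, (hT _ _).2 ht, rfl⟩
  · intro t ht
    have ht' := (hT _ _).1 ht
    rw [hw₁ _ (isPathVec_iff.2 ⟨t, ht', rfl⟩), pathWeight_listVec hrk ht']

end Sampler

end Trails

lemma integral_mul_comp_eq_sum {α Ω : Type*} [Fintype α] [MeasurableSpace Ω] {μ : Measure Ω}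
    {X : Ω → α} {c : Ω → ℝ} (hmeas : ∀ a, MeasurableSet {ω | X ω = a}) (hint : Integrable c μ)
    (F : α → ℝ) : ∫ ω, c ω * F (X ω) ∂μ = ∑ a, (∫ ω in {ω | X ω = a}, c ω ∂μ) * F a := by
  classical
  have h : ∀ ω, c ω * F (X ω) = ∑ a, {ω | X ω = a}.indicator c ω * F a := fun ω => by
    simp [Set.indicator_apply, ite_mul]
  simp only [h]
  rw [integral_finsetSum _ fun a _ => (hint.indicator (hmeas a)).mul_const _]
  refine Finset.sum_congr rfl fun a _ => ?_
  rw [integral_mul_const, integral_indicator (hmeas a)]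


/-- unbiasedness of the shortest-path loss estimator.
Let `q ∈ 𝒬` with `q(e) > 0` for all `e`, let the random path `p` have the law of the
Markovian sampler associated with `q`, and let `c` satisfy
`E[c ∣ p] = ∑_{e : p(e)=1} ℓ(e)`.  With
`ℓ̂(e) = c·(p(e)/q(e) − p(e_-)/q(e_-))` (vertex marginals, `p(s) = q(s) = 1`), for any
`q', q'' ∈ 𝒬`: `E[⟨ℓ̂, q' − q''⟩] = ⟨ℓ, q' − q''⟩`. -/
theorem stmt13 {V E : Type} [Fintype V] [Fintype E] [DecidableEq V] [DecidableEq E]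
    (src tgt : E → V) (s g : V)
    (hdag : ∃ rk : V → ℕ, ∀ e, rk (src e) < rk (tgt e))
    (q : E → ℝ) (hq : q ∈ flowSet src tgt s g) (hqpos : ∀ e, 0 < q e)
    (l : E → ℝ)
    {Ω : Type} [MeasurableSpace Ω] (μ : Measure Ω) [IsProbabilityMeasure μ]
    (pRV : Ω → (E → Bool)) (c : Ω → ℝ)
    (hmeas : ∀ p : E → Bool, MeasurableSet {ω | pRV ω = p})
    (hlaw₁ : ∀ p : E → Bool, IsPathVec src tgt s g p →
      (μ {ω | pRV ω = p}).toReal = pathWeight src q p)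
    (hlaw₂ : ∀ p : E → Bool, ¬ IsPathVec src tgt s g p → μ {ω | pRV ω = p} = 0)
    (hint : Integrable c μ)
    (hcond : ∀ p : E → Bool,
      ∫ ω in {ω | pRV ω = p}, c ω ∂μ
        = (∑ e ∈ Finset.univ.filter (fun e => p e = true), l e)
            * (μ {ω | pRV ω = p}).toReal)
    (q' q'' : E → ℝ) (hq' : q' ∈ flowSet src tgt s g) (hq'' : q'' ∈ flowSet src tgt s g) :
    ∫ ω, ∑ e, c ω * (pathVec (pRV ω) e / q e
          - vertMarg src s (pathVec (pRV ω)) (src e) / vertMarg src s q (src e))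
        * (q' e - q'' e) ∂μ
      = ∑ e, l e * (q' e - q'' e) := by
  obtain ⟨rk, hrk⟩ := hdag
  obtain ⟨T, hT⟩ : ∃ T : V → Finset (List E), ∀ u t, t ∈ T u ↔ IsTrail src tgt u g t :=
    ⟨fun u => (finite_trails hrk u g).toFinset, by simp⟩
  obtain ⟨D, hD⟩ := exists_potential_trailSum_estimator hrk hT hq hqpos l
  have hsrc := src_ne_sink hrk hq hqpos
  set Φ : (E → Bool) → ℝ := fun p => ∑ e, (pathVec p e / q e
    - vertMarg src s (pathVec p) (src e) / vertMarg src s q (src e)) * (q' e - q'' e) with hΦ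
  have hlhs : ∀ ω, ∑ e, c ω * (pathVec (pRV ω) e / q e
      - vertMarg src s (pathVec (pRV ω)) (src e) / vertMarg src s q (src e))
        * (q' e - q'' e) = c ω * Φ (pRV ω) := fun ω => by
    rw [hΦ, Finset.mul_sum]
    exact Finset.sum_congr rfl fun e _ => mul_assoc _ _ _
  simp only [hlhs]
  rw [integral_mul_comp_eq_sum hmeas hint]
  have hterm : ∀ p, (∫ ω in {ω | pRV ω = p}, c ω ∂μ) * Φ p =
      (μ {ω | pRV ω = p}).toReal * ((∑ e, l e * pathVec p e) * Φ p) := fun p => by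
    rw [hcond p, Finset.sum_filter]
    simp only [pathVec, mul_ite, mul_one, mul_zero]
    ring
  rw [Finset.sum_congr rfl fun p _ => hterm p, sum_eq_trailSum hrk hT hlaw₁
    (fun p hp => by rw [hlaw₂ p hp, ENNReal.toReal_zero])]
  have hΦt : ∀ t ∈ T s, (∑ e, l e * pathVec (listVec t) e) * Φ (listVec t) =
      ∑ e, (q' e - q'' e) * ((∑ f, l f * edgeInd f t) * (edgeInd e t / q e
        - (∑ d ∈ Finset.univ.filter (fun d => src d = src e), edgeInd d t)
          / outSum src q (src e))) := by
    intro t ht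
    have hflow : pathVec (listVec t) ∈ flowSet src tgt s g :=
      subset_convexHull ℝ _ ⟨_, isPathVec_iff.2 ⟨t, (hT _ _).1 ht, rfl⟩, rfl⟩
    rw [hΦ, Finset.mul_sum]
    refine Finset.sum_congr rfl fun e _ => ?_
    rw [vertMarg_eq_outSum hrk hflow (hsrc e), vertMarg_eq_outSum hrk hq (hsrc e),
      outSum.eq_def src (pathVec _)]
    simp only [pathVec_listVec]
    ring
  rw [trailSum_congr hΦt, trailSum_sum]
  simp only [trailSum_const_mul, hD]
  have h' := sum_potential_of_mem_flowSet hrk hq' D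
  have h'' := sum_potential_of_mem_flowSet hrk hq'' D
  have hsplit : ∑ e, (q' e - q'' e) * (l e + (D (tgt e) - D (src e))) =
      ∑ e, l e * (q' e - q'' e) + (∑ e, (D (tgt e) - D (src e)) * q' e
        - ∑ e, (D (tgt e) - D (src e)) * q'' e) := by
    rw [← Finset.sum_sub_distrib, ← Finset.sum_add_distrib]
    exact Finset.sum_congr rfl fun e _ => by ring
  rw [hsplit, h', h'', sub_self, add_zero]
end
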